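/- Let a, b ∈ 𝔻 be distinct. Then for every z ∈ 𝔻², lim_{ε→0, ε≠0} L^ε_{a0bV}(z) = min{ L_{a0b0}(z), L_{a0bV}(z) }, where the limit is over complex ε ≠ 0 tending to 0; that is, the Lempert functions with three simple poles (a,0), (b,0), (b,ε) converge, as (b,ε) collides with (b,0), to the corrected generalized Lempert function 𝐿̃_{a0bV} = min{L_{a0b0}, L_{a0bV}}. -/

import Mathlib

open Complex Metric Filter Topology

noncomputable section

/-- The open unit disc in `ℂ`. -/
def unitDisc : Set ℂ := Metric.ball 0 1

/-- Extended-real logarithm, with the convention `log 0 = ⊥`. -/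
def elog (x : ℝ) : EReal := if x = 0 then ⊥ else ((Real.log x : ℝ) : EReal)

/-- The Möbius involution of the unit disc exchanging `ξ` and `0`. -/
def mobius (ξ ζ : ℂ) : ℂ := (ξ - ζ) / (1 - (starRingEnd ℂ) ξ * ζ)

/-- An analytic disc in the bidisc `𝔻²`, given by its two components. -/
def AnalyticDisc2 (φ₁ φ₂ : ℂ → ℂ) : Prop :=
  DifferentiableOn ℂ φ₁ unitDisc ∧ DifferentiableOn ℂ φ₂ unitDisc ∧
  (∀ w ∈ unitDisc, φ₁ w ∈ unitDisc) ∧ (∀ w ∈ unitDisc, φ₂ w ∈ unitDisc)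

/-- The Lempert function with the two simple poles `(a,0)`, `(b,0)` in the bidisc. -/
def La0b0 (a b : ℂ) (z : ℂ × ℂ) : EReal :=
  sInf { t : EReal | ∃ (φ₁ φ₂ : ℂ → ℂ) (ζ₁ ζ₂ : ℂ),
    AnalyticDisc2 φ₁ φ₂ ∧ ζ₁ ∈ unitDisc ∧ ζ₂ ∈ unitDisc ∧
    φ₁ 0 = z.1 ∧ φ₂ 0 = z.2 ∧
    φ₁ ζ₁ = a ∧ φ₂ ζ₁ = 0 ∧ φ₁ ζ₂ = b ∧ φ₂ ζ₂ = 0 ∧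
    t = elog (‖ζ₁‖) + elog (‖ζ₂‖) }

/-- The generalized Lempert function with vertical indicator at `(a,0)` and
simple pole `(b,0)`. -/
def LaVb0 (a b : ℂ) (z : ℂ × ℂ) : EReal :=
  sInf { t : EReal | ∃ (φ₁ φ₂ : ℂ → ℂ) (ζ₁ ζ₂ : ℂ),
    AnalyticDisc2 φ₁ φ₂ ∧ ζ₁ ∈ unitDisc ∧ ζ₂ ∈ unitDisc ∧
    φ₁ 0 = z.1 ∧ φ₂ 0 = z.2 ∧
    φ₁ ζ₁ = a ∧ φ₂ ζ₁ = 0 ∧ φ₁ ζ₂ = b ∧ φ₂ ζ₂ = 0 ∧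
    deriv φ₁ ζ₁ = 0 ∧
    t = elog (‖ζ₁‖) + elog (‖ζ₁‖) + elog (‖ζ₂‖) }

/-- The generalized Lempert function with simple pole `(a,0)` and vertical
indicator at `(b,0)`. -/
def La0bV (a b : ℂ) (z : ℂ × ℂ) : EReal :=
  sInf { t : EReal | ∃ (φ₁ φ₂ : ℂ → ℂ) (ζ₁ ζ₂ : ℂ),
    AnalyticDisc2 φ₁ φ₂ ∧ ζ₁ ∈ unitDisc ∧ ζ₂ ∈ unitDisc ∧
    φ₁ 0 = z.1 ∧ φ₂ 0 = z.2 ∧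
    φ₁ ζ₁ = a ∧ φ₂ ζ₁ = 0 ∧ φ₁ ζ₂ = b ∧ φ₂ ζ₂ = 0 ∧
    deriv φ₁ ζ₂ = 0 ∧
    t = elog (‖ζ₁‖) + elog (‖ζ₂‖) + elog (‖ζ₂‖) }

/-- The generalized Lempert function with vertical indicators at `(a,0)` and `(b,0)`. -/
def LaVbV (a b : ℂ) (z : ℂ × ℂ) : EReal :=
  sInf { t : EReal | ∃ (φ₁ φ₂ : ℂ → ℂ) (ζ₁ ζ₂ : ℂ),
    AnalyticDisc2 φ₁ φ₂ ∧ ζ₁ ∈ unitDisc ∧ ζ₂ ∈ unitDisc ∧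
    φ₁ 0 = z.1 ∧ φ₂ 0 = z.2 ∧
    φ₁ ζ₁ = a ∧ φ₂ ζ₁ = 0 ∧ φ₁ ζ₂ = b ∧ φ₂ ζ₂ = 0 ∧
    deriv φ₁ ζ₁ = 0 ∧ deriv φ₁ ζ₂ = 0 ∧
    t = elog (‖ζ₁‖) + elog (‖ζ₁‖)
        + elog (‖ζ₂‖) + elog (‖ζ₂‖) }

/-- Coman's Lempert function with the three simple poles `(a,0)`, `(b,0)`, `(b,ε)`. -/
def Leps3 (a b ε : ℂ) (z : ℂ × ℂ) : EReal :=
  sInf { t : EReal | ∃ (φ₁ φ₂ : ℂ → ℂ) (ζ₁ ζ₂ ζ₃ : ℂ),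
    AnalyticDisc2 φ₁ φ₂ ∧ ζ₁ ∈ unitDisc ∧ ζ₂ ∈ unitDisc ∧ ζ₃ ∈ unitDisc ∧
    φ₁ 0 = z.1 ∧ φ₂ 0 = z.2 ∧
    φ₁ ζ₁ = a ∧ φ₂ ζ₁ = 0 ∧ φ₁ ζ₂ = b ∧ φ₂ ζ₂ = 0 ∧ φ₁ ζ₃ = b ∧ φ₂ ζ₃ = ε ∧
    t = elog (‖ζ₁‖) + elog (‖ζ₂‖) + elog (‖ζ₃‖) }

/-- Coman's Lempert function with the four simple poles
`(a,0)`, `(b,0)`, `(b,ε)`, `(a,ε)`. -/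
def Leps4 (a b ε : ℂ) (z : ℂ × ℂ) : EReal :=
  sInf { t : EReal | ∃ (φ₁ φ₂ : ℂ → ℂ) (ζ₁ ζ₂ ζ₃ ζ₄ : ℂ),
    AnalyticDisc2 φ₁ φ₂ ∧ ζ₁ ∈ unitDisc ∧ ζ₂ ∈ unitDisc ∧ ζ₃ ∈ unitDisc ∧ ζ₄ ∈ unitDisc ∧
    φ₁ 0 = z.1 ∧ φ₂ 0 = z.2 ∧
    φ₁ ζ₁ = a ∧ φ₂ ζ₁ = 0 ∧ φ₁ ζ₂ = b ∧ φ₂ ζ₂ = 0 ∧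
    φ₁ ζ₃ = b ∧ φ₂ ζ₃ = ε ∧ φ₁ ζ₄ = a ∧ φ₂ ζ₄ = ε ∧
    t = elog (‖ζ₁‖) + elog (‖ζ₂‖)
        + elog (‖ζ₃‖) + elog (‖ζ₄‖) }

lemma mem_disc {x : ℂ} : x ∈ unitDisc ↔ ‖x‖ < 1 := by simp [unitDisc]

lemma isOpen_disc : IsOpen unitDisc := Metric.isOpen_ball

lemma zero_mem_disc : (0 : ℂ) ∈ unitDisc := by simp [mem_disc]

lemma mobius_den_ne {ξ ζ : ℂ} (hξ : ‖ξ‖ < 1) (hζ : ‖ζ‖ ≤ 1) :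
    1 - (starRingEnd ℂ) ξ * ζ ≠ 0 := by
  intro h
  have h1 : (starRingEnd ℂ) ξ * ζ = 1 := (sub_eq_zero.1 h).symm
  have h2 : ‖ξ‖ * ‖ζ‖ = 1 := by
    have := congrArg norm h1
    simpa using this
  nlinarith [norm_nonneg ξ, norm_nonneg ζ]

lemma mobius_aux (ξ ζ : ℂ) : ‖1 - (starRingEnd ℂ) ξ * ζ‖ ^ 2 - ‖ξ - ζ‖ ^ 2
    = (1 - ‖ξ‖ ^ 2) * (1 - ‖ζ‖ ^ 2) := by
  simp only [Complex.sq_norm, Complex.normSq_apply]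
  simp
  ring

lemma one_sub_mobius_sq {ξ ζ : ℂ} (hξ : ‖ξ‖ < 1) (hζ : ‖ζ‖ ≤ 1) :
    1 - ‖mobius ξ ζ‖ ^ 2 = (1 - ‖ξ‖ ^ 2) * (1 - ‖ζ‖ ^ 2) / ‖1 - (starRingEnd ℂ) ξ * ζ‖ ^ 2 := by
  have h := mobius_den_ne hξ hζ
  have h' : ‖1 - (starRingEnd ℂ) ξ * ζ‖ ≠ 0 := norm_ne_zero_iff.2 h
  rw [← mobius_aux, mobius, norm_div, sub_div, div_self (pow_ne_zero 2 h'), div_pow]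

lemma mobius_norm_lt {ξ ζ : ℂ} (hξ : ‖ξ‖ < 1) (hζ : ‖ζ‖ < 1) : ‖mobius ξ ζ‖ < 1 := by
  have h := one_sub_mobius_sq hξ hζ.le
  have h' : 0 < ‖1 - (starRingEnd ℂ) ξ * ζ‖ := norm_pos_iff.2 (mobius_den_ne hξ hζ.le)
  have h1 : 0 < 1 - ‖ξ‖ ^ 2 := by nlinarith [norm_nonneg ξ]
  have h2 : 0 < 1 - ‖ζ‖ ^ 2 := by nlinarith [norm_nonneg ζ]
  have : 0 < 1 - ‖mobius ξ ζ‖ ^ 2 := by rw [h]; positivity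
  nlinarith [norm_nonneg (mobius ξ ζ)]

/-- uniform bound for Möbius maps on compact subdiscs -/
lemma mobius_bound {c r : ℝ} (hc : c < 1) (hr : r < 1) :
    ∃ s : ℝ, 0 < s ∧ s < 1 ∧ ∀ ξ ζ : ℂ, ‖ξ‖ ≤ c → ‖ζ‖ ≤ r → ‖mobius ξ ζ‖ ≤ s := by
  by_cases hc0 : c < 0
  · exact ⟨1/2, by norm_num, by norm_num, fun ξ ζ h _ => by linarith [norm_nonneg ξ]⟩
  by_cases hr0 : r < 0
  · exact ⟨1/2, by norm_num, by norm_num, fun ξ ζ _ h => by linarith [norm_nonneg ζ]⟩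
  push Not at hc0 hr0
  have h1 : 0 < 1 - c ^ 2 := by nlinarith
  have h2 : 0 < 1 - r ^ 2 := by nlinarith
  have h3 : (1 - c ^ 2) * (1 - r ^ 2) ≤ 1 := by nlinarith [sq_nonneg c, sq_nonneg r]
  have h4 : 0 < (1 - c ^ 2) * (1 - r ^ 2) := by positivity
  refine ⟨Real.sqrt (1 - (1 - c ^ 2) * (1 - r ^ 2) / 4), ?_, ?_, ?_⟩
  · apply Real.sqrt_pos.2; linarith
  · rw [Real.sqrt_lt' one_pos]; linarith
  · intro ξ ζ hξ hζ
    apply Real.le_sqrt_of_sq_le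
    have hξ1 : ‖ξ‖ < 1 := by linarith
    have hζ1 : ‖ζ‖ < 1 := by linarith
    have h := one_sub_mobius_sq hξ1 hζ1.le
    have h' : 0 < ‖1 - (starRingEnd ℂ) ξ * ζ‖ := norm_pos_iff.2 (mobius_den_ne hξ1 hζ1.le)
    have h5 : ‖1 - (starRingEnd ℂ) ξ * ζ‖ ≤ 2 := by
      refine (norm_sub_le _ _).trans ?_
      simp only [norm_one, norm_mul, RCLike.norm_conj]
      nlinarith [norm_nonneg ξ, norm_nonneg ζ]
    have h6 : (1 - c ^ 2) * (1 - r ^ 2) ≤ (1 - ‖ξ‖ ^ 2) * (1 - ‖ζ‖ ^ 2) := by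
      apply mul_le_mul _ _ h2.le
      · nlinarith [norm_nonneg ξ]
      · nlinarith [norm_nonneg ξ]
      · nlinarith [norm_nonneg ζ]
    have h7 : (1 - c ^ 2) * (1 - r ^ 2) / 4
        ≤ (1 - ‖ξ‖ ^ 2) * (1 - ‖ζ‖ ^ 2) / ‖1 - (starRingEnd ℂ) ξ * ζ‖ ^ 2 := by
      apply div_le_div₀ (by linarith) h6 (by positivity)
      nlinarith
    linarith

lemma mobius_mobius {ξ ζ : ℂ} (hξ : ‖ξ‖ < 1) (hζ : ‖ζ‖ < 1) : mobius ξ (mobius ξ ζ) = ζ := by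
  have h := mobius_den_ne hξ hζ.le
  have h2 := mobius_den_ne hξ (mobius_norm_lt hξ hζ).le
  have h3 := mobius_den_ne hξ hξ.le
  unfold mobius at h2
  unfold mobius
  rw [div_eq_iff h2]
  have hY := div_mul_cancel₀ (ξ - ζ) h
  linear_combination -hY

lemma mobius_self (ξ : ℂ) : mobius ξ ξ = 0 := by simp [mobius]
lemma mobius_zero (ξ : ℂ) : mobius ξ 0 = ξ := by simp [mobius]

lemma mobius_eq_zero {ξ ζ : ℂ} (hξ : ‖ξ‖ < 1) (hζ : ‖ζ‖ < 1) (h : mobius ξ ζ = 0) : ζ = ξ := by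
  have := mobius_mobius hξ hζ
  rw [h, mobius_zero] at this
  exact this.symm

lemma mobius_diffAt {ξ ζ : ℂ} (hξ : ‖ξ‖ < 1) (hζ : ‖ζ‖ < 1) :
    DifferentiableAt ℂ (mobius ξ) ζ := by
  unfold mobius
  exact DifferentiableAt.fun_div (by fun_prop) (by fun_prop) (mobius_den_ne hξ hζ.le)

lemma mobius_diffOn {ξ : ℂ} (hξ : ‖ξ‖ < 1) : DifferentiableOn ℂ (mobius ξ) unitDisc :=
  fun _ hζ => (mobius_diffAt hξ (mem_disc.1 hζ)).differentiableWithinAt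

lemma mobius_mapsTo {ξ : ℂ} (hξ : ‖ξ‖ < 1) : Set.MapsTo (mobius ξ) unitDisc unitDisc :=
  fun _ hζ => mem_disc.2 (mobius_norm_lt hξ (mem_disc.1 hζ))

lemma mobius_norm_comm (ξ ζ : ℂ) : ‖mobius ξ ζ‖ = ‖mobius ζ ξ‖ := by
  unfold mobius
  rw [norm_div, norm_div, norm_sub_rev]
  congr 1
  rw [← RCLike.norm_conj]
  simp [mul_comm]

/-- Division by a Blaschke factor. -/
lemma blaschke_div {f : ℂ → ℂ} {p : ℂ} (hf : DifferentiableOn ℂ f unitDisc)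
    (hb : ∀ w ∈ unitDisc, ‖f w‖ ≤ 1) (hp : p ∈ unitDisc) (h0 : f p = 0) :
    ∃ g : ℂ → ℂ, DifferentiableOn ℂ g unitDisc ∧ (∀ w ∈ unitDisc, ‖g w‖ ≤ 1) ∧
      ∀ w ∈ unitDisc, f w = mobius p w * g w := by
  have hp' := mem_disc.1 hp
  set F : ℂ → ℂ := fun w => f (mobius p w) with hF
  have hFd : DifferentiableOn ℂ F unitDisc := hf.comp (mobius_diffOn hp') (mobius_mapsTo hp')
  have hF0 : F 0 = 0 := by simp [hF, mobius_zero, h0]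
  have hmaps : Set.MapsTo F (ball 0 1) (closedBall (F 0) 1) := by
    intro w hw
    rw [hF0]
    simpa using hb _ (mobius_mapsTo hp' hw)
  have hdsl : DifferentiableOn ℂ (dslope F 0) unitDisc :=
    (Complex.differentiableOn_dslope (isOpen_disc.mem_nhds zero_mem_disc)).2 hFd
  refine ⟨fun w => dslope F 0 (mobius p w), hdsl.comp (mobius_diffOn hp') (mobius_mapsTo hp'),
    ?_, ?_⟩
  · intro w hw
    have := Complex.norm_dslope_le_div_of_mapsTo_ball hFd hmaps (mobius_mapsTo hp' hw)
    simpa using this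
  · intro w hw
    have := sub_smul_dslope F 0 (mobius p w)
    rw [hF0] at this
    simp only [sub_zero, smul_eq_mul] at this
    rw [this, hF]
    simp only
    rw [mobius_mobius hp' (mem_disc.1 hw)]

/-- Uniform bound on compact subdiscs for self maps of the disc. -/
lemma schwarz_bound {c r : ℝ} (hc : c < 1) (hr : r < 1) :
    ∃ s : ℝ, 0 < s ∧ s < 1 ∧ ∀ f : ℂ → ℂ, DifferentiableOn ℂ f unitDisc →
      (∀ w ∈ unitDisc, f w ∈ unitDisc) → ‖f 0‖ ≤ c → ∀ w : ℂ, ‖w‖ ≤ r → ‖f w‖ ≤ s := by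
  obtain ⟨s, h0, h1, hs⟩ := mobius_bound hc hr
  refine ⟨s, h0, h1, fun f hf hm hf0 w hw => ?_⟩
  have hf0' := mem_disc.1 (hm 0 zero_mem_disc)
  have hwd : w ∈ unitDisc := mem_disc.2 (by linarith)
  obtain ⟨g, -, hg, he⟩ := blaschke_div (f := fun w => mobius (f 0) (f w))
    ((mobius_diffOn hf0').comp hf hm)
    (fun w hw => (mobius_norm_lt hf0' (mem_disc.1 (hm w hw))).le) zero_mem_disc (mobius_self _)
  have h2 := he w hwd
  have h3 : ‖mobius (f 0) (f w)‖ ≤ r := by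
    rw [h2, norm_mul]
    have : ‖mobius 0 w‖ = ‖w‖ := by simp [mobius]
    rw [this]
    have := hg w hwd
    nlinarith [norm_nonneg w, norm_nonneg (g w)]
  have := hs (f 0) _ hf0 h3
  rwa [mobius_mobius hf0' (mem_disc.1 (hm w hwd))] at this

lemma exists_K_alg {β c x m d : ℂ} (hβ : β ≠ 0) (hX : 1 - c * x ≠ 0) (hd : d ≠ 0)
    (f : m * (1 - c * x) = β - x) :
    m / β = 1 + x * d * -((1 - c * β) / (β * (1 - c * x) * d)) := by
  generalize hXX : 1 - c * x = X at f hX ⊢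
  field_simp
  linear_combination f + β * hXX

/-- Auxiliary multiplier: equal to one at the nodes, zero at a point near the boundary. -/
lemma exists_K {p q : ℂ} (hp : p ∈ unitDisc) (hq : q ∈ unitDisc) {s : ℝ} (h0 : 0 < s)
    (h1 : s < 1) :
    ∃ (w : ℂ) (K h : ℂ → ℂ), w ∈ unitDisc ∧ DifferentiableOn ℂ K unitDisc ∧
      DifferentiableOn ℂ h unitDisc ∧
      (∀ ζ ∈ unitDisc, K ζ = 1 + ζ * (ζ - p) * (ζ - q) * h ζ) ∧ K w = 0 ∧
      ∀ ζ ∈ unitDisc, ‖K ζ‖ ≤ 1 / s := by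
  have hp' := mem_disc.1 hp
  have hq' := mem_disc.1 hq
  set B : ℂ → ℂ := fun ζ => ζ * mobius p ζ * mobius q ζ with hB
  have hBd : DifferentiableOn ℂ B unitDisc :=
    (differentiableOn_id.mul (mobius_diffOn hp')).mul (mobius_diffOn hq')
  have hB1 : ∀ ζ ∈ unitDisc, ‖B ζ‖ < 1 := by
    intro ζ hζ
    have := mem_disc.1 hζ
    have h2 := mobius_norm_lt hp' this
    have h3 := mobius_norm_lt hq' this
    simp only [hB, norm_mul]
    have h4 : ‖ζ‖ * ‖mobius p ζ‖ < 1 := mul_lt_one_of_nonneg_of_lt_one_left (norm_nonneg _) this h2.le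
    exact mul_lt_one_of_nonneg_of_lt_one_left (by positivity) h4 h3.le
  have hcont : ContinuousAt B 1 := by
    have e1 : ContinuousAt (mobius p) 1 := by
      unfold mobius
      exact ContinuousAt.div (by fun_prop) (by fun_prop) (mobius_den_ne hp' (by simp))
    have e2 : ContinuousAt (mobius q) 1 := by
      unfold mobius
      exact ContinuousAt.div (by fun_prop) (by fun_prop) (mobius_den_ne hq' (by simp))
    exact (continuousAt_id.mul e1).mul e2
  have hm1 : ∀ ξ : ℂ, ‖ξ‖ < 1 → ‖mobius ξ 1‖ = 1 := by
    intro ξ hξ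
    have := one_sub_mobius_sq hξ (ζ := 1) (by simp)
    simp only [norm_one, one_pow, sub_self, mul_zero, zero_div] at this
    nlinarith [norm_nonneg (mobius ξ 1)]
  have hB11 : ‖B 1‖ = 1 := by simp [hB, hm1 p hp', hm1 q hq']
  have hev : ∀ᶠ r : ℝ in 𝓝[<] 1, s < ‖B (r : ℂ)‖ := by
    have : ContinuousAt (fun r : ℝ => ‖B (r : ℂ)‖) 1 := by
      apply ContinuousAt.norm
      apply ContinuousAt.comp (f := fun r : ℝ => (r : ℂ)) (g := B)
      · simpa using hcont
      · exact Complex.continuous_ofReal.continuousAt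
    have h2 := this.eventually (lt_mem_nhds (show s < ‖B ((1 : ℝ) : ℂ)‖ by simp [hB11, h1]))
    exact h2.filter_mono nhdsWithin_le_nhds
  have hev2 : ∀ᶠ r : ℝ in 𝓝[<] 1, 0 < r := (lt_mem_nhds one_pos).filter_mono nhdsWithin_le_nhds
  obtain ⟨r, hr, hr0, hr1⟩ := (hev.and (hev2.and self_mem_nhdsWithin)).exists
  have hw : (r : ℂ) ∈ unitDisc := by
    rw [mem_disc]; simpa [abs_of_pos hr0] using hr1
  set β := B (r : ℂ) with hβ
  have hβ1 := hB1 _ hw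
  have hβ0 : β ≠ 0 := by
    rw [← norm_pos_iff]; linarith
  refine ⟨r, fun ζ => mobius β (B ζ) / β, fun ζ => -((1 - (starRingEnd ℂ) β * β) /
      (β * (1 - (starRingEnd ℂ) β * B ζ) *
        ((1 - (starRingEnd ℂ) p * ζ) * (1 - (starRingEnd ℂ) q * ζ)))), hw, ?_, ?_, ?_, ?_, ?_⟩
  · exact ((mobius_diffOn hβ1).comp hBd (fun ζ hζ => mem_disc.2 (hB1 ζ hζ))).div_const _
  · apply DifferentiableOn.neg
    apply DifferentiableOn.div (by fun_prop)
    · have : DifferentiableOn ℂ (fun ζ => 1 - (starRingEnd ℂ) β * B ζ) unitDisc :=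
        (hBd.const_mul _).const_sub _
      exact (this.const_mul _).mul (by fun_prop)
    · intro ζ hζ
      have hz := (mem_disc.1 hζ).le
      exact mul_ne_zero (mul_ne_zero hβ0 (mobius_den_ne hβ1 (hB1 ζ hζ).le))
        (mul_ne_zero (mobius_den_ne hp' hz) (mobius_den_ne hq' hz))
  · intro ζ hζ
    have hz := (mem_disc.1 hζ).le
    have e1 := mobius_den_ne hp' hz
    have e2 := mobius_den_ne hq' hz
    have e3 := mobius_den_ne hβ1 (hB1 ζ hζ).le
    have e5 : ζ * (ζ - p) * (ζ - q) = B ζ *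
      ((1 - (starRingEnd ℂ) p * ζ) * (1 - (starRingEnd ℂ) q * ζ)) := by
      have f1 : mobius p ζ * (1 - (starRingEnd ℂ) p * ζ) = p - ζ := div_mul_cancel₀ _ e1
      have f2 : mobius q ζ * (1 - (starRingEnd ℂ) q * ζ) = q - ζ := div_mul_cancel₀ _ e2
      calc ζ * (ζ - p) * (ζ - q) = ζ * (p - ζ) * (q - ζ) := by ring
        _ = _ := by rw [← f1, ← f2]; simp only [hB]; ring
    beta_reduce
    rw [e5]
    have f3 : mobius β (B ζ) * (1 - (starRingEnd ℂ) β * B ζ) = β - B ζ := div_mul_cancel₀ _ e3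
    exact exists_K_alg hβ0 e3 (mul_ne_zero e1 e2) f3
  · simp only
    rw [← hβ, mobius_self, zero_div]
  · intro ζ hζ
    simp only [norm_div]
    apply div_le_div₀ (by norm_num) (mobius_norm_lt hβ1 (hB1 ζ hζ)).le h0 hr.le

lemma K_deriv {K h : ℂ → ℂ} {p : ℂ} (hp : p ∈ unitDisc) (hh : DifferentiableOn ℂ h unitDisc)
    (hK : ∀ ζ ∈ unitDisc, K ζ = 1 + ζ * (ζ - p) * (ζ - p) * h ζ) : HasDerivAt K 0 p := by
  have h1 : HasDerivAt h (deriv h p) p :=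
    (hh.differentiableAt (isOpen_disc.mem_nhds hp)).hasDerivAt
  have h2 : HasDerivAt (fun ζ : ℂ => ζ - p) 1 p := (hasDerivAt_id p).sub_const p
  have h3 := ((((hasDerivAt_id p).mul h2).mul h2).mul h1).const_add 1
  have h4 : K =ᶠ[𝓝 p] fun ζ => 1 + ζ * (ζ - p) * (ζ - p) * h ζ :=
    Filter.mem_of_superset (isOpen_disc.mem_nhds hp) hK
  refine HasDerivAt.congr_of_eventuallyEq ?_ h4
  refine h3.congr_deriv ?_
  simp

/-- A pole may be added near the boundary of the disc. -/
lemma addPole {f₁ f₂ : ℂ → ℂ} {s : ℝ} {p q c : ℂ} (hf₁ : DifferentiableOn ℂ f₁ unitDisc)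
    (hf₂ : DifferentiableOn ℂ f₂ unitDisc) (hs1 : s < 1)
    (hb₁ : ∀ ζ ∈ unitDisc, ‖f₁ ζ‖ ≤ s) (hb₂ : ∀ ζ ∈ unitDisc, ‖f₂ ζ‖ ≤ s)
    (hp : p ∈ unitDisc) (hq : q ∈ unitDisc) (hc : c ∈ unitDisc) :
    ∃ w ∈ unitDisc, ∃ η > (0 : ℝ), ∀ ε : ℂ, ‖ε‖ < η → ∃ g₁ g₂ : ℂ → ℂ,
      AnalyticDisc2 g₁ g₂ ∧ g₁ 0 = f₁ 0 ∧ g₂ 0 = f₂ 0 ∧ g₁ p = f₁ p ∧ g₂ p = f₂ p ∧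
      g₁ q = f₁ q ∧ g₂ q = f₂ q ∧ g₁ w = c ∧ g₂ w = ε ∧
      (p = q → deriv f₁ p = 0 → deriv g₁ p = 0) := by
  have hc' := mem_disc.1 hc
  obtain ⟨s₁, hs₁0, hs₁1, hs₁⟩ := mobius_bound hc' hs1
  have hs0 : 0 ≤ s := (norm_nonneg _).trans (hb₁ 0 zero_mem_disc)
  set S := (max s₁ s + 1) / 2 with hS
  have hm1 : max s₁ s < 1 := max_lt hs₁1 hs1
  have hSs₁ : s₁ < S := by have := le_max_left s₁ s; linarith
  have hSs : s < S := by have := le_max_right s₁ s; linarith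
  have hS1 : S < 1 := by linarith
  have hS0 : 0 < S := by linarith
  obtain ⟨w, K, h, hw, hKd, hhd, hK, hKw, hKb⟩ := exists_K hp hq hS0 hS1
  have hK0 : K 0 = 1 := by simp [hK 0 zero_mem_disc]
  have hKp : K p = 1 := by simp [hK p hp]
  have hKq : K q = 1 := by simp [hK q hq]
  have hfd : ∀ ζ ∈ unitDisc, ‖f₁ ζ‖ < 1 := fun ζ hζ => (hb₁ ζ hζ).trans_lt hs1
  have hprod : ∀ ζ ∈ unitDisc, ‖mobius c (f₁ ζ) * K ζ‖ < 1 := by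
    intro ζ hζ
    rw [norm_mul]
    calc ‖mobius c (f₁ ζ)‖ * ‖K ζ‖ ≤ s₁ * (1 / S) := by
          apply mul_le_mul (hs₁ _ _ le_rfl (hb₁ ζ hζ)) (hKb ζ hζ) (norm_nonneg _) hs₁0.le
      _ < 1 := by rw [mul_one_div, div_lt_one hS0]; exact hSs₁
  refine ⟨w, hw, (1 - s / S) / (1 + 1 / S), ?_, fun ε hε => ?_⟩
  · apply div_pos
    · rw [sub_pos, div_lt_one hS0]; exact hSs
    · positivity
  have hin : DifferentiableOn ℂ (fun ζ => mobius c (f₁ ζ) * K ζ) unitDisc :=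
    ((mobius_diffOn hc').comp hf₁ (fun ζ hζ => mem_disc.2 (hfd ζ hζ))).mul hKd
  refine ⟨fun ζ => mobius c (mobius c (f₁ ζ) * K ζ), fun ζ => f₂ ζ * K ζ + ε * (1 - K ζ),
    ⟨?_, ?_, ?_, ?_⟩, ?_, ?_, ?_, ?_, ?_, ?_, ?_, ?_, ?_⟩
  · exact (mobius_diffOn hc').comp hin (fun ζ hζ => mem_disc.2 (hprod ζ hζ))
  · exact (hf₂.mul hKd).add ((hKd.const_sub 1).const_mul ε)
  · intro ζ hζ
    exact mem_disc.2 (mobius_norm_lt hc' (hprod ζ hζ))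
  · intro ζ hζ
    rw [mem_disc]
    have hk := hKb ζ hζ
    have e1 : ‖f₂ ζ * K ζ‖ ≤ s * (1 / S) := by
      rw [norm_mul]; exact mul_le_mul (hb₂ ζ hζ) hk (norm_nonneg _) hs0
    have e2 : ‖ε * (1 - K ζ)‖ ≤ ‖ε‖ * (1 + 1 / S) := by
      rw [norm_mul]
      apply mul_le_mul_of_nonneg_left _ (norm_nonneg _)
      refine (norm_sub_le _ _).trans ?_
      rw [norm_one]; linarith
    have e3 : ‖ε‖ * (1 + 1 / S) < 1 - s / S := by
      rwa [lt_div_iff₀ (by positivity)] at hε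
    calc _ ≤ _ := norm_add_le _ _
      _ < 1 := by rw [mul_one_div] at e1; linarith
  · simp only [hK0, mul_one]; exact mobius_mobius hc' (hfd _ zero_mem_disc)
  · simp [hK0]
  · simp only [hKp, mul_one]; exact mobius_mobius hc' (hfd _ hp)
  · simp [hKp]
  · simp only [hKq, mul_one]; exact mobius_mobius hc' (hfd _ hq)
  · simp [hKq]
  · simp [hKw, mobius_zero]
  · simp [hKw]
  · rintro rfl hd
    have d1 : HasDerivAt f₁ 0 p := by
      rw [← hd]; exact (hf₁.differentiableAt (isOpen_disc.mem_nhds hp)).hasDerivAt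
    have d2 := K_deriv hp hhd hK
    have d3 : HasDerivAt (fun ζ => mobius c (f₁ ζ)) (deriv (mobius c) (f₁ p) * 0) p :=
      (mobius_diffAt hc' (hfd p hp)).hasDerivAt.comp p d1
    have d4 := d3.mul d2
    have d5 := (mobius_diffAt hc' (hprod p hp)).hasDerivAt.comp p d4
    have := d5.deriv
    simpa [Function.comp_def] using this

def Has2 (a b : ℂ) (z : ℂ × ℂ) (κ : ℝ) : Prop :=
  ∃ (φ₁ φ₂ : ℂ → ℂ) (ζ₁ ζ₂ : ℂ),
    AnalyticDisc2 φ₁ φ₂ ∧ ζ₁ ∈ unitDisc ∧ ζ₂ ∈ unitDisc ∧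
    φ₁ 0 = z.1 ∧ φ₂ 0 = z.2 ∧
    φ₁ ζ₁ = a ∧ φ₂ ζ₁ = 0 ∧ φ₁ ζ₂ = b ∧ φ₂ ζ₂ = 0 ∧ ‖ζ₁‖ * ‖ζ₂‖ < κ

def HasV (a b : ℂ) (z : ℂ × ℂ) (κ : ℝ) : Prop :=
  ∃ (φ₁ φ₂ : ℂ → ℂ) (ζ₁ ζ₂ : ℂ),
    AnalyticDisc2 φ₁ φ₂ ∧ ζ₁ ∈ unitDisc ∧ ζ₂ ∈ unitDisc ∧
    φ₁ 0 = z.1 ∧ φ₂ 0 = z.2 ∧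
    φ₁ ζ₁ = a ∧ φ₂ ζ₁ = 0 ∧ φ₁ ζ₂ = b ∧ φ₂ ζ₂ = 0 ∧ deriv φ₁ ζ₂ = 0 ∧
    ‖ζ₁‖ * ‖ζ₂‖ * ‖ζ₂‖ < κ

def Has3 (a b ε : ℂ) (z : ℂ × ℂ) (κ : ℝ) : Prop :=
  ∃ (φ₁ φ₂ : ℂ → ℂ) (ζ₁ ζ₂ ζ₃ : ℂ),
    AnalyticDisc2 φ₁ φ₂ ∧ ζ₁ ∈ unitDisc ∧ ζ₂ ∈ unitDisc ∧ ζ₃ ∈ unitDisc ∧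
    φ₁ 0 = z.1 ∧ φ₂ 0 = z.2 ∧
    φ₁ ζ₁ = a ∧ φ₂ ζ₁ = 0 ∧ φ₁ ζ₂ = b ∧ φ₂ ζ₂ = 0 ∧ φ₁ ζ₃ = b ∧ φ₂ ζ₃ = ε ∧
    ‖ζ₁‖ * ‖ζ₂‖ * ‖ζ₃‖ < κ

lemma elog_mul {x y : ℝ} : elog x + elog y = elog (x * y) := by
  unfold elog
  by_cases hx : x = 0
  · simp [hx]
  by_cases hy : y = 0
  · simp [hy]
  simp [hx, hy, Real.log_mul hx hy]

lemma elog_lt {x c : ℝ} (hx : 0 ≤ x) : elog x < (c : EReal) ↔ x < Real.exp c := by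
  unfold elog
  by_cases h : x = 0
  · simp [h, Real.exp_pos, EReal.bot_lt_coe]
  · have : 0 < x := lt_of_le_of_ne hx (Ne.symm h)
    rw [if_neg h, EReal.coe_lt_coe_iff, Real.log_lt_iff_lt_exp this]

lemma La0b0_lt {a b : ℂ} {z : ℂ × ℂ} {c : ℝ} :
    La0b0 a b z < (c : EReal) ↔ Has2 a b z (Real.exp c) := by
  unfold La0b0 Has2
  rw [sInf_lt_iff]
  constructor
  · rintro ⟨t, ⟨φ₁, φ₂, ζ₁, ζ₂, h1, h2, h3, h4, h5, h6, h7, h8, h9, rfl⟩, ht⟩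
    rw [elog_mul, elog_lt (by positivity)] at ht
    exact ⟨φ₁, φ₂, ζ₁, ζ₂, h1, h2, h3, h4, h5, h6, h7, h8, h9, ht⟩
  · rintro ⟨φ₁, φ₂, ζ₁, ζ₂, h1, h2, h3, h4, h5, h6, h7, h8, h9, ht⟩
    refine ⟨_, ⟨φ₁, φ₂, ζ₁, ζ₂, h1, h2, h3, h4, h5, h6, h7, h8, h9, rfl⟩, ?_⟩
    rwa [elog_mul, elog_lt (by positivity)]

lemma La0bV_lt {a b : ℂ} {z : ℂ × ℂ} {c : ℝ} :
    La0bV a b z < (c : EReal) ↔ HasV a b z (Real.exp c) := by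
  unfold La0bV HasV
  rw [sInf_lt_iff]
  constructor
  · rintro ⟨t, ⟨φ₁, φ₂, ζ₁, ζ₂, h1, h2, h3, h4, h5, h6, h7, h8, h9, h10, rfl⟩, ht⟩
    rw [elog_mul, elog_mul, elog_lt (by positivity)] at ht
    exact ⟨φ₁, φ₂, ζ₁, ζ₂, h1, h2, h3, h4, h5, h6, h7, h8, h9, h10, ht⟩
  · rintro ⟨φ₁, φ₂, ζ₁, ζ₂, h1, h2, h3, h4, h5, h6, h7, h8, h9, h10, ht⟩
    refine ⟨_, ⟨φ₁, φ₂, ζ₁, ζ₂, h1, h2, h3, h4, h5, h6, h7, h8, h9, h10, rfl⟩, ?_⟩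
    rwa [elog_mul, elog_mul, elog_lt (by positivity)]

lemma Leps3_lt {a b ε : ℂ} {z : ℂ × ℂ} {c : ℝ} :
    Leps3 a b ε z < (c : EReal) ↔ Has3 a b ε z (Real.exp c) := by
  unfold Leps3 Has3
  rw [sInf_lt_iff]
  constructor
  · rintro ⟨t, ⟨φ₁, φ₂, ζ₁, ζ₂, ζ₃, h1, h2, h3, h4, h5, h6, h7, h8, h9, h10, h11, h12, rfl⟩, ht⟩
    rw [elog_mul, elog_mul, elog_lt (by positivity)] at ht
    exact ⟨φ₁, φ₂, ζ₁, ζ₂, ζ₃, h1, h2, h3, h4, h5, h6, h7, h8, h9, h10, h11, h12, ht⟩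
  · rintro ⟨φ₁, φ₂, ζ₁, ζ₂, ζ₃, h1, h2, h3, h4, h5, h6, h7, h8, h9, h10, h11, h12, ht⟩
    refine ⟨_, ⟨φ₁, φ₂, ζ₁, ζ₂, ζ₃, h1, h2, h3, h4, h5, h6, h7, h8, h9, h10, h11, h12, rfl⟩, ?_⟩
    rwa [elog_mul, elog_mul, elog_lt (by positivity)]

/-- Rescaling of an analytic disc. -/
lemma rescale {φ₁ φ₂ : ℂ → ℂ} (h : AnalyticDisc2 φ₁ φ₂) {r : ℝ} (hr0 : 0 < r) (hr1 : r < 1) :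
    ∃ s : ℝ, s < 1 ∧ DifferentiableOn ℂ (fun ζ => φ₁ (r * ζ)) unitDisc ∧
      DifferentiableOn ℂ (fun ζ => φ₂ (r * ζ)) unitDisc ∧
      (∀ ζ ∈ unitDisc, ‖φ₁ (r * ζ)‖ ≤ s) ∧ (∀ ζ ∈ unitDisc, ‖φ₂ (r * ζ)‖ ≤ s) := by
  obtain ⟨hd1, hd2, hm1, hm2⟩ := h
  obtain ⟨s₁, -, hs₁1, hs₁⟩ := schwarz_bound (mem_disc.1 (hm1 0 zero_mem_disc)) hr1
  obtain ⟨s₂, -, hs₂1, hs₂⟩ := schwarz_bound (mem_disc.1 (hm2 0 zero_mem_disc)) hr1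
  have hn : ∀ ζ ∈ unitDisc, ‖(r : ℂ) * ζ‖ ≤ r := by
    intro ζ hζ
    have := mem_disc.1 hζ
    rw [norm_mul, Complex.norm_real, Real.norm_of_nonneg hr0.le]
    nlinarith
  have hmem : Set.MapsTo (fun ζ : ℂ => (r : ℂ) * ζ) unitDisc unitDisc := fun ζ hζ =>
    mem_disc.2 ((hn ζ hζ).trans_lt hr1)
  refine ⟨max s₁ s₂, max_lt hs₁1 hs₂1, hd1.comp (by fun_prop) hmem, hd2.comp (by fun_prop) hmem,
    fun ζ hζ => (hs₁ φ₁ hd1 hm1 le_rfl _ (hn ζ hζ)).trans (le_max_left _ _),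
    fun ζ hζ => (hs₂ φ₂ hd2 hm2 le_rfl _ (hn ζ hζ)).trans (le_max_right _ _)⟩

lemma exists_scale {x y v κ : ℝ} (hx : x < 1) (hy : y < 1) (h : x * y * v < κ) :
    ∃ r : ℝ, 0 < r ∧ r < 1 ∧ x / r < 1 ∧ y / r < 1 ∧ (x / r) * (y / r) * (v / r) < κ := by
  have c1 : ∀ x : ℝ, Tendsto (fun r : ℝ => x / r) (𝓝 1) (𝓝 x) := fun x => by
    have : ContinuousAt (fun r : ℝ => x / r) 1 :=
      ContinuousAt.div (by fun_prop) (by fun_prop) one_ne_zero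
    simpa [ContinuousAt] using this
  have := (lt_mem_nhds (one_pos (α := ℝ))).and
      (((c1 x).eventually_lt_const hx).and
      (((c1 y).eventually_lt_const hy).and
      ((((c1 x).mul (c1 y)).mul (c1 v)).eventually_lt_const h)))
  obtain ⟨r, ⟨h1, h2, h3, h4⟩, hr⟩ :=
    ((this.filter_mono (nhdsWithin_le_nhds (s := Set.Iio 1))).and self_mem_nhdsWithin).exists
  exact ⟨r, h1, hr, h2, h3, h4⟩

lemma small_eps {η : ℝ} (hη : 0 < η) : ∀ᶠ ε in 𝓝[≠] (0 : ℂ), ‖ε‖ < η := by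
  have : ∀ᶠ ε in 𝓝 (0 : ℂ), ‖ε‖ < η :=
    Filter.mem_of_superset (Metric.ball_mem_nhds (0 : ℂ) hη) (fun x hx => by simpa using hx)
  exact this.filter_mono nhdsWithin_le_nhds

lemma upper1 {a b : ℂ} (hb : b ∈ unitDisc) {z : ℂ × ℂ} {κ : ℝ} (h : Has2 a b z κ) :
    ∀ᶠ ε in 𝓝[≠] (0 : ℂ), Has3 a b ε z κ := by
  obtain ⟨φ₁, φ₂, ζ₁, ζ₂, hφ, h1, h2, e1, e2, e3, e4, e5, e6, hκ⟩ := h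
  obtain ⟨r, hr0, hrl, hr1, hr2, hr3⟩ := exists_scale (v := 1) (mem_disc.1 h1) (mem_disc.1 h2)
    (by simpa using hκ)
  obtain ⟨s, hs, d1, d2, b1, b2⟩ := rescale hφ hr0 hrl
  have hrc : (r : ℂ) ≠ 0 := by exact_mod_cast hr0.ne'
  have n1 : ∀ x : ℂ, ‖x / (r : ℂ)‖ = ‖x‖ / r := fun x => by
    rw [norm_div, Complex.norm_real, Real.norm_of_nonneg hr0.le]
  have hp : ζ₁ / (r : ℂ) ∈ unitDisc := by rw [mem_disc, n1]; exact hr1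
  have hq : ζ₂ / (r : ℂ) ∈ unitDisc := by rw [mem_disc, n1]; exact hr2
  obtain ⟨w, hw, η, hη, H⟩ := addPole d1 d2 hs b1 b2 hp hq hb
  filter_upwards [small_eps hη] with ε hε
  obtain ⟨g₁, g₂, hg, k1, k2, k3, k4, k5, k6, k7, k8, -⟩ := H ε hε
  simp only [mul_div_cancel₀ _ hrc, mul_zero] at k1 k2 k3 k4 k5 k6
  refine ⟨g₁, g₂, _, _, w, hg, hp, hq, hw, k1.trans e1, k2.trans e2, k3.trans e3, k4.trans e4,
    k5.trans e5, k6.trans e6, k7, k8, ?_⟩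
  rw [n1, n1]
  refine lt_of_le_of_lt ?_ hr3
  apply mul_le_mul_of_nonneg_left _ (by positivity)
  exact (mem_disc.1 hw).le.trans ((one_le_div hr0).2 hrl.le)

lemma norm_Q_le {p q ζ : ℂ} (hp : p ∈ unitDisc) (hq : q ∈ unitDisc) (hζ : ζ ∈ unitDisc) :
    ‖ζ * (ζ - p) * (ζ - q)‖ ≤ 4 := by
  have h1 := mem_disc.1 hp
  have h2 := mem_disc.1 hq
  have h3 := mem_disc.1 hζ
  have e1 : ‖ζ - p‖ ≤ 2 := (norm_sub_le _ _).trans (by linarith)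
  have e2 : ‖ζ - q‖ ≤ 2 := (norm_sub_le _ _).trans (by linarith)
  rw [norm_mul, norm_mul]
  calc ‖ζ‖ * ‖ζ - p‖ * ‖ζ - q‖ ≤ 1 * 2 * 2 := by gcongr
    _ = 4 := by norm_num

lemma hasDerivAt_Q (p q : ℂ) :
    HasDerivAt (fun ζ : ℂ => ζ * (ζ - p) * (ζ - q)) (q * (q - p)) q := by
  have h2 : HasDerivAt (fun ζ : ℂ => ζ - q) 1 q := (hasDerivAt_id q).sub_const q
  have h1 : HasDerivAt (fun ζ : ℂ => ζ - p) 1 q := (hasDerivAt_id q).sub_const p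
  refine (((hasDerivAt_id q).mul h1).mul h2).congr_deriv ?_
  simp

lemma upper2 {a b : ℂ} (hb : b ∈ unitDisc) (hab : a ≠ b) {z : ℂ × ℂ} {κ : ℝ}
    (h : HasV a b z κ) : ∀ᶠ ε in 𝓝[≠] (0 : ℂ), Has3 a b ε z κ := by
  obtain ⟨φ₁, φ₂, ζ₁, ζ₂, hφ, h1, h2, e1, e2, e3, e4, e5, e6, e7, hκ⟩ := h
  by_cases hζ₂ : ζ₂ = 0
  · apply upper1 hb
    refine ⟨φ₁, φ₂, ζ₁, ζ₂, hφ, h1, h2, e1, e2, e3, e4, e5, e6, ?_⟩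
    simpa [hζ₂] using hκ
  have hne : ζ₁ ≠ ζ₂ := by
    rintro rfl; exact hab (e3.symm.trans e5)
  obtain ⟨r, hr0, hrl, hr1, hr2, hr3⟩ := exists_scale (mem_disc.1 h1) (mem_disc.1 h2) hκ
  obtain ⟨s, hs, d1, d2, b1, b2⟩ := rescale hφ hr0 hrl
  have hrc : (r : ℂ) ≠ 0 := by exact_mod_cast hr0.ne'
  have n1 : ∀ x : ℂ, ‖x / (r : ℂ)‖ = ‖x‖ / r := fun x => by
    rw [norm_div, Complex.norm_real, Real.norm_of_nonneg hr0.le]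
  have hp : ζ₁ / (r : ℂ) ∈ unitDisc := by rw [mem_disc, n1]; exact hr1
  have hq : ζ₂ / (r : ℂ) ∈ unitDisc := by rw [mem_disc, n1]; exact hr2
  rw [← n1, ← n1] at hr3
  have hd : HasDerivAt (fun ζ => φ₁ (r * ζ)) 0 (ζ₂ / (r : ℂ)) := by
    have i1 : HasDerivAt φ₁ 0 ((r : ℂ) * (ζ₂ / (r : ℂ))) := by
      rw [mul_div_cancel₀ _ hrc, ← e7]
      exact (hφ.1.differentiableAt (isOpen_disc.mem_nhds h2)).hasDerivAt
    have i2 : HasDerivAt (fun ζ : ℂ => (r : ℂ) * ζ) (r : ℂ) (ζ₂ / (r : ℂ)) := by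
      simpa using (hasDerivAt_id (ζ₂ / (r : ℂ))).const_mul (r : ℂ)
    simpa [Function.comp_def] using i1.comp _ i2
  have hpq : ζ₁ / (r : ℂ) ≠ ζ₂ / (r : ℂ) := by
    intro h; exact hne ((div_left_inj' hrc).1 h)
  have hq0 : ζ₂ / (r : ℂ) ≠ 0 := div_ne_zero hζ₂ hrc
  have v10 : φ₁ (r * 0) = z.1 := by rw [mul_zero, e1]
  have v20 : φ₂ (r * 0) = z.2 := by rw [mul_zero, e2]
  have v1p : φ₁ (r * (ζ₁ / (r : ℂ))) = a := by rw [mul_div_cancel₀ _ hrc, e3]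
  have v2p : φ₂ (r * (ζ₁ / (r : ℂ))) = 0 := by rw [mul_div_cancel₀ _ hrc, e4]
  have v1q : φ₁ (r * (ζ₂ / (r : ℂ))) = b := by rw [mul_div_cancel₀ _ hrc, e5]
  have v2q : φ₂ (r * (ζ₂ / (r : ℂ))) = 0 := by rw [mul_div_cancel₀ _ hrc, e6]
  have n2 := n1 ζ₂
  generalize ζ₁ / (r : ℂ) = p at *
  generalize ζ₂ / (r : ℂ) = q at *
  set f₁ : ℂ → ℂ := fun ζ => φ₁ (r * ζ) with hf₁
  set f₂ : ℂ → ℂ := fun ζ => φ₂ (r * ζ) with hf₂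
  set Q : ℂ → ℂ := fun ζ => ζ * (ζ - p) * (ζ - q) with hQ
  have hQd : Differentiable ℂ Q := by simp only [hQ]; fun_prop
  have hQ' : HasDerivAt Q (q * (q - p)) q := hasDerivAt_Q p q
  have hQ4 : ∀ ζ ∈ unitDisc, ‖Q ζ‖ ≤ 4 := fun ζ hζ => norm_Q_le hp hq hζ
  have hA : q * (q - p) ≠ 0 := mul_ne_zero hq0 (sub_ne_zero.2 hpq.symm)
  have hA' : 0 < ‖q * (q - p)‖ := norm_pos_iff.2 hA
  have hs' : 0 < 1 - s := by linarith
  -- make the second component non-degenerate at `q`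
  obtain ⟨η, hη, hηD⟩ : ∃ η : ℂ, ‖η‖ ≤ (1 - s) / 8 ∧ deriv f₂ q + η * (q * (q - p)) ≠ 0 := by
    by_cases hz : deriv f₂ q = 0
    · refine ⟨((1 - s) / 8 : ℝ), ?_, ?_⟩
      · rw [Complex.norm_real, Real.norm_of_nonneg (by linarith)]
      · rw [hz, zero_add]
        refine mul_ne_zero ?_ hA
        rw [Complex.ofReal_ne_zero]; positivity
    · exact ⟨0, by simp; linarith, by simpa using hz⟩
  set F₂ : ℂ → ℂ := fun ζ => f₂ ζ + η * Q ζ with hF₂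
  have hF₂d : DifferentiableOn ℂ F₂ unitDisc := d2.add (hQd.differentiableOn.const_mul η)
  have hF₂q : HasDerivAt F₂ (deriv f₂ q + η * (q * (q - p))) q :=
    (d2.differentiableAt (isOpen_disc.mem_nhds hq)).hasDerivAt.add (hQ'.const_mul η)
  have hF₂s : HasStrictDerivAt F₂ (deriv f₂ q + η * (q * (q - p))) q := by
    have := (hF₂d.analyticAt (isOpen_disc.mem_nhds hq)).hasStrictDerivAt
    rwa [hF₂q.deriv] at this
  have hQq : Q q = 0 := by simp [hQ]
  have hQp : Q p = 0 := by simp [hQ]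
  have hQ0 : Q 0 = 0 := by simp [hQ]
  have hF₂0 : F₂ q = 0 := by simp only [hF₂, hQq]; rw [show f₂ q = 0 from v2q]; simp
  have hmap := hF₂s.map_nhds_eq hηD
  rw [hF₂0] at hmap
  have hU : ∀ᶠ ζ in 𝓝 q, ζ ∈ unitDisc ∧
      ‖f₁ ζ - b‖ ≤ ‖q * (q - p)‖ * (1 - s) / 16 * ‖ζ - q‖ ∧
      ‖q * (q - p)‖ / 2 < ‖ζ * (ζ - p)‖ ∧ ‖p‖ * ‖q‖ * ‖ζ‖ < κ := by
    refine Filter.Eventually.and (isOpen_disc.mem_nhds hq)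
      (Filter.Eventually.and ?_ (Filter.Eventually.and ?_ ?_))
    · have := hd.isLittleO
      have h3 := this.def (c := ‖q * (q - p)‖ * (1 - s) / 16) (by positivity)
      have vb : f₁ q = b := v1q
      simpa [vb] using h3
    · have : Continuous fun ζ : ℂ => ‖ζ * (ζ - p)‖ := by fun_prop
      exact this.continuousAt.eventually (lt_mem_nhds (by linarith))
    · have : Continuous fun ζ : ℂ => ‖p‖ * ‖q‖ * ‖ζ‖ := by fun_prop
      refine this.continuousAt.eventually (gt_mem_nhds ?_)
      refine lt_of_le_of_lt ?_ hr3
      apply mul_le_mul_of_nonneg_left _ (by positivity)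
      exact le_rfl
  have hI := Filter.image_mem_map (m := F₂) hU
  rw [hmap] at hI
  have hI' : ∀ᶠ ε in 𝓝[≠] (0 : ℂ), ε ∈ F₂ '' _ := Filter.Eventually.filter_mono nhdsWithin_le_nhds hI
  filter_upwards [hI', self_mem_nhdsWithin] with ε hε hε0
  obtain ⟨w, ⟨hw, w1, w2, w3⟩, hwε⟩ := hε
  have hwq : w ≠ q := by
    rintro rfl; exact hε0 (hwε.symm.trans hF₂0)
  have hwq' : 0 < ‖w - q‖ := norm_pos_iff.2 (sub_ne_zero.2 hwq)
  have hQw : ‖Q w‖ = ‖w * (w - p)‖ * ‖w - q‖ := by simp only [hQ, norm_mul]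
  have hQw0 : 0 < ‖Q w‖ := by rw [hQw]; apply mul_pos _ hwq'; linarith
  set C := (b - f₁ w) / Q w with hC
  have hCn : ‖C‖ ≤ (1 - s) / 8 := by
    rw [hC, norm_div, div_le_iff₀ hQw0, norm_sub_rev, hQw]
    refine w1.trans ?_
    have : ‖q * (q - p)‖ / 2 * ‖w - q‖ ≤ ‖w * (w - p)‖ * ‖w - q‖ := by gcongr
    nlinarith
  have hbd : ∀ (g : ℂ → ℂ) (c : ℂ), (∀ ζ ∈ unitDisc, ‖g ζ‖ ≤ s) → ‖c‖ ≤ (1 - s) / 8 →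
      ∀ ζ ∈ unitDisc, g ζ + c * Q ζ ∈ unitDisc := by
    intro g c hg hc ζ hζ
    rw [mem_disc]
    have k1 : ‖c * Q ζ‖ ≤ (1 - s) / 8 * 4 := by
      rw [norm_mul]; exact mul_le_mul hc (hQ4 ζ hζ) (norm_nonneg _) (by linarith)
    have := norm_add_le (g ζ) (c * Q ζ)
    have := hg ζ hζ
    linarith
  refine ⟨fun ζ => f₁ ζ + C * Q ζ, F₂, p, q, w, ⟨d1.add (hQd.differentiableOn.const_mul C), hF₂d,
    hbd _ _ b1 hCn, hbd _ _ b2 hη⟩, hp, hq, hw, ?_, ?_, ?_, ?_, ?_, hF₂0, ?_, hwε, w3⟩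
  · simp [hQ0, hf₁, e1]
  · simp [hF₂, hQ0, hf₂, e2]
  · simp only [hQp, hf₁, v1p]; simp
  · simp only [hF₂, hQp, hf₂, v2p]; simp
  · simp only [hQq, hf₁, v1q]; simp
  · have : Q w ≠ 0 := norm_pos_iff.1 hQw0
    simp only [hC]; rw [div_mul_cancel₀ _ this]; ring

lemma has2_symm {a b : ℂ} {z : ℂ × ℂ} {κ : ℝ} (h : Has2 a b z κ) : Has2 b a z κ := by
  obtain ⟨φ₁, φ₂, ζ₁, ζ₂, hφ, h1, h2, e1, e2, e3, e4, e5, e6, hκ⟩ := h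
  exact ⟨φ₁, φ₂, ζ₂, ζ₁, hφ, h2, h1, e1, e2, e5, e6, e3, e4, by rwa [mul_comm]⟩

lemma has2_onePole {a b : ℂ} (ha : a ∈ unitDisc) (hb : b ∈ unitDisc) {z : ℂ × ℂ}
    (hz1 : z.1 ∈ unitDisc) {T κ : ℝ} (hT1 : T < 1)
    (hTκ : T < κ) (hpT : ‖mobius z.1 a‖ < T) (hzT : ‖z.2‖ < T) : Has2 a b z κ := by
  have hz1' := mem_disc.1 hz1
  have ha' := mem_disc.1 ha
  have hT0 : 0 < T := (norm_nonneg _).trans_lt hzT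
  have hTc : (T : ℂ) ≠ 0 := by exact_mod_cast hT0.ne'
  have hTn : ‖(T : ℂ)‖ = T := by rw [Complex.norm_real, Real.norm_of_nonneg hT0.le]
  have hTd : (T : ℂ) ∈ unitDisc := by rw [mem_disc, hTn]; exact hT1
  set p := mobius z.1 a with hp
  have hl : ‖p‖ / T < 1 := (div_lt_one hT0).2 hpT
  have hl2 : ‖z.2‖ / T < 1 := (div_lt_one hT0).2 hzT
  obtain ⟨s, -, hs1, hs⟩ := mobius_bound hz1' hl
  have hin : ∀ ζ ∈ unitDisc, ‖p / T * ζ‖ ≤ ‖p‖ / T := by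
    intro ζ hζ
    rw [norm_mul, norm_div, hTn]
    exact mul_le_of_le_one_right (by positivity) (mem_disc.1 hζ).le
  have d1 : DifferentiableOn ℂ (fun ζ => mobius z.1 (p / T * ζ)) unitDisc :=
    (mobius_diffOn hz1').comp (by fun_prop) (fun ζ hζ => mem_disc.2 ((hin ζ hζ).trans_lt hl))
  have d2 : DifferentiableOn ℂ (fun ζ => z.2 / T * mobius T ζ) unitDisc :=
    (mobius_diffOn (mem_disc.1 hTd)).const_mul _
  have b1 : ∀ ζ ∈ unitDisc, ‖mobius z.1 (p / T * ζ)‖ ≤ max s (‖z.2‖ / T) :=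
    fun ζ hζ => (hs _ _ le_rfl (hin ζ hζ)).trans (le_max_left _ _)
  have b2 : ∀ ζ ∈ unitDisc, ‖z.2 / T * mobius T ζ‖ ≤ max s (‖z.2‖ / T) := by
    intro ζ hζ
    refine le_trans ?_ (le_max_right _ _)
    rw [norm_mul, norm_div, hTn]
    exact mul_le_of_le_one_right (by positivity)
      (mobius_norm_lt (mem_disc.1 hTd) (mem_disc.1 hζ)).le
  obtain ⟨w, hw, η, hη, H⟩ := addPole d1 d2 (max_lt hs1 hl2) b1 b2 hTd hTd hb
  obtain ⟨g₁, g₂, hg, k1, k2, k3, k4, -, -, k7, k8, -⟩ := H 0 (by simpa using hη)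
  refine ⟨g₁, g₂, T, w, hg, hTd, hw, ?_, ?_, ?_, ?_, k7, k8, ?_⟩
  · rw [k1]; simp [mobius_zero]
  · rw [k2]; simp only [mobius_zero]; rw [div_mul_cancel₀ _ hTc]
  · rw [k3, div_mul_cancel₀ _ hTc, hp, mobius_mobius hz1' ha']
  · rw [k4]; simp [mobius_self]
  · rw [hTn]
    exact (mul_le_of_le_one_right hT0.le (mem_disc.1 hw).le).trans_lt hTκ

lemma has2_of_lt {a b : ℂ} (ha : a ∈ unitDisc) (hb : b ∈ unitDisc) {z : ℂ × ℂ}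
    (hz1 : z.1 ∈ unitDisc) (hz2 : z.2 ∈ unitDisc) {κ : ℝ}
    (h1 : ‖z.2‖ < κ) (h2 : ‖mobius z.1 a‖ * ‖mobius z.1 b‖ < κ) : Has2 a b z κ := by
  have hz1' := mem_disc.1 hz1
  have hz2' := mem_disc.1 hz2
  have ha' := mem_disc.1 ha
  have hb' := mem_disc.1 hb
  have hp1 := mobius_norm_lt hz1' ha'
  have hq1 := mobius_norm_lt hz1' hb'
  obtain ⟨T, hT, hTk⟩ : ∃ T, max ‖z.2‖ (‖mobius z.1 a‖ * ‖mobius z.1 b‖) < T ∧ T < min κ 1 := by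
    apply exists_between
    refine max_lt (lt_min h1 hz2') (lt_min h2 ?_)
    exact mul_lt_one_of_nonneg_of_lt_one_left (norm_nonneg _) hp1 hq1.le
  obtain ⟨hT1, hT2⟩ := max_lt_iff.1 hT
  obtain ⟨hTκ, hTo⟩ := lt_min_iff.1 hTk
  by_cases hpT : ‖mobius z.1 a‖ < T
  · exact has2_onePole ha hb hz1 hTo hTκ hpT hT1
  by_cases hqT : ‖mobius z.1 b‖ < T
  · exact has2_symm (has2_onePole hb ha hz1 hTo hTκ hqT hT1)
  push Not at hpT hqT
  set p := mobius z.1 a with hp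
  set q := mobius z.1 b with hq
  have hT0 : 0 < T := (norm_nonneg _).trans_lt hT1
  have hp0 : 0 < ‖p‖ := by linarith
  have hq0 : 0 < ‖q‖ := by linarith
  set l := Real.sqrt (‖p‖ * ‖q‖ / T) with hl
  have hl0 : 0 < l := Real.sqrt_pos.2 (by positivity)
  have hlsq : l ^ 2 = ‖p‖ * ‖q‖ / T := Real.sq_sqrt (by positivity)
  have hl1 : l < 1 := by
    rw [hl, Real.sqrt_lt' one_pos, div_lt_iff₀ hT0]; linarith
  have hpl : ‖p‖ < l := by
    apply Real.lt_sqrt_of_sq_lt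
    rw [lt_div_iff₀ hT0]; nlinarith
  have hql : ‖q‖ < l := by
    apply Real.lt_sqrt_of_sq_lt
    rw [lt_div_iff₀ hT0]; nlinarith
  have hlc : (l : ℂ) ≠ 0 := by exact_mod_cast hl0.ne'
  have hln : ‖(l : ℂ)‖ = l := by rw [Complex.norm_real, Real.norm_of_nonneg hl0.le]
  have n1 : ‖p / (l : ℂ)‖ = ‖p‖ / l := by rw [norm_div, hln]
  have n2 : ‖q / (l : ℂ)‖ = ‖q‖ / l := by rw [norm_div, hln]
  have m1 : p / (l : ℂ) ∈ unitDisc := by rw [mem_disc, n1, div_lt_one hl0]; exact hpl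
  have m2 : q / (l : ℂ) ∈ unitDisc := by rw [mem_disc, n2, div_lt_one hl0]; exact hql
  have hprod : ‖p / (l : ℂ)‖ * ‖q / (l : ℂ)‖ = T := by
    rw [n1, n2, div_mul_div_comm, ← sq, hlsq]; field_simp
  have hin : ∀ ζ ∈ unitDisc, (l : ℂ) * ζ ∈ unitDisc := by
    intro ζ hζ
    have := mem_disc.1 hζ
    rw [mem_disc, norm_mul, hln]
    nlinarith [norm_nonneg ζ]
  have hP : p / (l : ℂ) * (q / (l : ℂ)) ≠ 0 := by
    rw [← norm_pos_iff, norm_mul, hprod]; exact hT0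
  refine ⟨fun ζ => mobius z.1 (l * ζ), fun ζ => z.2 / (p / (l : ℂ) * (q / (l : ℂ))) *
    (mobius (p / l) ζ * mobius (q / l) ζ), p / l, q / l, ⟨?_, ?_, ?_, ?_⟩, m1, m2, ?_, ?_, ?_, ?_,
    ?_, ?_, ?_⟩
  · exact (mobius_diffOn hz1').comp (by fun_prop) hin
  · exact ((mobius_diffOn (mem_disc.1 m1)).mul (mobius_diffOn (mem_disc.1 m2))).const_mul _
  · intro ζ hζ; exact mobius_mapsTo hz1' (hin ζ hζ)
  · intro ζ hζ
    rw [mem_disc, norm_mul, norm_div, norm_mul, hprod, norm_mul]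
    have i1 := mobius_norm_lt (mem_disc.1 m1) (mem_disc.1 hζ)
    have i2 := mobius_norm_lt (mem_disc.1 m2) (mem_disc.1 hζ)
    have i3 : ‖z.2‖ / T < 1 := (div_lt_one hT0).2 hT1
    have i4 : ‖mobius (p / l) ζ‖ * ‖mobius (q / l) ζ‖ ≤ 1 := by
      exact mul_le_one₀ i1.le (norm_nonneg _) i2.le
    exact mul_lt_one_of_nonneg_of_lt_one_left (by positivity) i3 i4
  · simp [mobius_zero]
  · simp only [mobius_zero]; rw [div_mul_cancel₀ _ hP]
  · simp only; rw [mul_div_cancel₀ _ hlc, hp, mobius_mobius hz1' ha']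
  · simp [mobius_self]
  · simp only; rw [mul_div_cancel₀ _ hlc, hq, mobius_mobius hz1' hb']
  · simp [mobius_self]
  · rw [hprod]; exact hTκ

lemma two_zero {f : ℂ → ℂ} {p q : ℂ} (hf : DifferentiableOn ℂ f unitDisc)
    (hb : ∀ w ∈ unitDisc, ‖f w‖ ≤ 1) (hp : p ∈ unitDisc) (hq : q ∈ unitDisc) (hpq : p ≠ q)
    (h0 : f p = 0) (h1 : f q = 0) :
    ∃ g : ℂ → ℂ, DifferentiableOn ℂ g unitDisc ∧ (∀ w ∈ unitDisc, ‖g w‖ ≤ 1) ∧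
      ∀ w ∈ unitDisc, f w = mobius p w * (mobius q w * g w) := by
  obtain ⟨g, gd, gb, ge⟩ := blaschke_div hf hb hp h0
  have hg : g q = 0 := by
    have := ge q hq
    rw [h1] at this
    rcases mul_eq_zero.1 this.symm with h | h
    · exact absurd (mobius_eq_zero (mem_disc.1 hp) (mem_disc.1 hq) h).symm hpq
    · exact h
  obtain ⟨k, kd, kb, ke⟩ := blaschke_div gd gb hq hg
  exact ⟨k, kd, kb, fun w hw => by rw [ge w hw, ke w hw]⟩

lemma schwarz_pick {f : ℂ → ℂ} {p c w : ℂ} (hf : DifferentiableOn ℂ f unitDisc)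
    (hm : ∀ w ∈ unitDisc, f w ∈ unitDisc) (hp : p ∈ unitDisc) (hc : f p = c)
    (hw : w ∈ unitDisc) : ‖mobius c (f w)‖ ≤ ‖mobius p w‖ := by
  have hc' : c ∈ unitDisc := hc ▸ hm p hp
  obtain ⟨g, -, gb, ge⟩ := blaschke_div (f := fun w => mobius c (f w))
    ((mobius_diffOn (mem_disc.1 hc')).comp hf hm)
    (fun w hw => (mobius_norm_lt (mem_disc.1 hc') (mem_disc.1 (hm w hw))).le) hp
    (by simp [hc, mobius_self])
  have := ge w hw
  rw [this, norm_mul]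
  exact mul_le_of_le_one_right (norm_nonneg _) (gb w hw)

lemma schwarz_pick2 {f : ℂ → ℂ} {p q c w : ℂ} (hf : DifferentiableOn ℂ f unitDisc)
    (hm : ∀ w ∈ unitDisc, f w ∈ unitDisc) (hp : p ∈ unitDisc) (hq : q ∈ unitDisc) (hpq : p ≠ q)
    (hc : f p = c) (hc2 : f q = c)
    (hw : w ∈ unitDisc) : ‖mobius c (f w)‖ ≤ ‖mobius p w‖ * ‖mobius q w‖ := by
  have hc' : c ∈ unitDisc := hc ▸ hm p hp
  obtain ⟨g, -, gb, ge⟩ := two_zero (f := fun w => mobius c (f w))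
    ((mobius_diffOn (mem_disc.1 hc')).comp hf hm)
    (fun w hw => (mobius_norm_lt (mem_disc.1 hc') (mem_disc.1 (hm w hw))).le) hp hq hpq
    (by simp [hc, mobius_self]) (by simp [hc2, mobius_self])
  have := ge w hw
  rw [this, norm_mul, norm_mul]
  apply mul_le_mul_of_nonneg_left _ (norm_nonneg _)
  exact mul_le_of_le_one_right (norm_nonneg _) (gb w hw)

lemma norm_zero_le {h : ℂ → ℂ} {p : ℂ} (hd : DifferentiableOn ℂ h unitDisc)
    (hb : ∀ w ∈ unitDisc, ‖h w‖ ≤ 1) (hp : p ∈ unitDisc) : ‖h 0‖ ≤ ‖p‖ + 2 * ‖h p‖ := by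
  have hN : 0 < 1 + ‖h p‖ := by positivity
  have hNn : ‖((1 + ‖h p‖ : ℝ) : ℂ)‖ = 1 + ‖h p‖ := by
    rw [Complex.norm_real, Real.norm_of_nonneg hN.le]
  obtain ⟨g, -, gb, ge⟩ := blaschke_div (f := fun w => (h w - h p) / ((1 + ‖h p‖ : ℝ) : ℂ))
    ((hd.sub_const _).div_const _)
    (fun w hw => by
      rw [norm_div, hNn, div_le_one hN]
      exact (norm_sub_le _ _).trans (by linarith [hb w hw])) hp (by simp)
  have h1 := congrArg norm (ge 0 zero_mem_disc)
  rw [norm_div, hNn, norm_mul, mobius_zero] at h1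
  have h2 : ‖h 0 - h p‖ / (1 + ‖h p‖) ≤ ‖p‖ := by
    rw [h1]; exact mul_le_of_le_one_right (norm_nonneg _) (gb 0 zero_mem_disc)
  rw [div_le_iff₀ hN] at h2
  have h3 : ‖h 0‖ ≤ ‖h 0 - h p‖ + ‖h p‖ := by
    simpa using norm_add_le (h 0 - h p) (h p)
  nlinarith [mem_disc.1 hp, norm_nonneg (h p), norm_nonneg p]

lemma mobius_den_le {p q : ℂ} (hp : p ∈ unitDisc) (hq : q ∈ unitDisc) :
    ‖1 - (starRingEnd ℂ) p * q‖ ≤ 2 ∧ 1 - ‖p‖ ≤ ‖1 - (starRingEnd ℂ) p * q‖ := by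
  have h1 := mem_disc.1 hp
  have h2 := mem_disc.1 hq
  have h3 : ‖(starRingEnd ℂ) p * q‖ ≤ ‖p‖ := by
    rw [norm_mul, RCLike.norm_conj]
    exact mul_le_of_le_one_right (norm_nonneg _) h2.le
  constructor
  · refine (norm_sub_le _ _).trans ?_
    rw [norm_one]; linarith
  · have := norm_sub_norm_le (1 : ℂ) ((starRingEnd ℂ) p * q)
    rw [norm_one] at this; linarith

lemma sub_le_mobius {p q : ℂ} (hp : p ∈ unitDisc) (hq : q ∈ unitDisc) :
    ‖p - q‖ ≤ 2 * ‖mobius p q‖ ∧ ‖mobius p q‖ * (1 - ‖p‖) ≤ ‖p - q‖ := by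
  have h0 : 0 < ‖1 - (starRingEnd ℂ) p * q‖ :=
    norm_pos_iff.2 (mobius_den_ne (mem_disc.1 hp) (mem_disc.1 hq).le)
  obtain ⟨h1, h2⟩ := mobius_den_le hp hq
  have h3 : ‖mobius p q‖ * ‖1 - (starRingEnd ℂ) p * q‖ = ‖p - q‖ := by
    rw [mobius, norm_div, div_mul_cancel₀ _ h0.ne']
  rw [← h3]
  constructor
  · nlinarith [norm_nonneg (mobius p q)]
  · exact mul_le_mul_of_nonneg_left h2 (norm_nonneg _)

lemma deriv_bound {f : ℂ → ℂ} {p q b : ℂ} (hf : DifferentiableOn ℂ f unitDisc)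
    (hm : ∀ w ∈ unitDisc, f w ∈ unitDisc) (hp : p ∈ unitDisc) (hq : q ∈ unitDisc) (hpq : p ≠ q)
    (hb : f p = b) (hb2 : f q = b) : ‖deriv f p‖ * (1 - ‖p‖) ≤ 2 * ‖mobius p q‖ := by
  have hbd : ‖b‖ < 1 := mem_disc.1 (hb ▸ hm p hp)
  obtain ⟨g, gd, gb, ge⟩ := two_zero (f := fun w => (f w - b) / 2)
    ((hf.sub_const _).div_const _)
    (fun w hw => by
      rw [norm_div, RCLike.norm_ofNat, div_le_one two_pos]
      exact (norm_sub_le _ _).trans (by linarith [mem_disc.1 (hm w hw)])) hp hq hpq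
    (by simp [hb]) (by simp [hb2])
  have hN := isOpen_disc.mem_nhds hp
  have hk : HasDerivAt (fun w => mobius q w * g w) (deriv (fun w => mobius q w * g w) p) p :=
    (((mobius_diffOn (mem_disc.1 hq)).mul gd).differentiableAt hN).hasDerivAt
  have hD0 := mobius_den_ne (mem_disc.1 hp) (mem_disc.1 hp).le
  have hmo : HasDerivAt (mobius p) (-1 / (1 - (starRingEnd ℂ) p * p)) p := by
    have i1 : HasDerivAt (fun ζ : ℂ => p - ζ) (-1) p := (hasDerivAt_id p).const_sub p
    have i2 : HasDerivAt (fun ζ : ℂ => 1 - (starRingEnd ℂ) p * ζ) (-((starRingEnd ℂ) p * 1)) p :=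
      ((hasDerivAt_id p).const_mul _).const_sub 1
    refine (i1.div i2 hD0).congr_deriv ?_
    field_simp
    ring
  have hfd : HasDerivAt f (2 * (-1 / (1 - (starRingEnd ℂ) p * p) * (mobius q p * g p))) p := by
    have := ((hmo.mul hk).const_mul 2).const_add b
    refine HasDerivAt.congr_of_eventuallyEq (this.congr_deriv ?_)
      (Filter.mem_of_superset hN ?_)
    · simp [mobius_self]
    · intro w hw
      have := ge w hw
      simp only [Set.mem_setOf_eq, Pi.mul_apply]
      rw [← this]; ring
  rw [hfd.deriv]
  have h0 : 0 < ‖1 - (starRingEnd ℂ) p * p‖ := norm_pos_iff.2 hD0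
  obtain ⟨-, h2⟩ := mobius_den_le hp hp
  have hg := gb p hp
  rw [norm_mul, norm_mul, norm_mul, norm_div, norm_neg, norm_one, RCLike.norm_ofNat,
    mobius_norm_comm q p]
  have k1 : 1 / ‖1 - (starRingEnd ℂ) p * p‖ * (1 - ‖p‖) ≤ 1 := by
    rw [one_div_mul_eq_div, div_le_one h0]; exact h2
  have k2 : ‖mobius p q‖ * ‖g p‖ ≤ ‖mobius p q‖ := mul_le_of_le_one_right (norm_nonneg _) hg
  have k0 : 0 ≤ ‖mobius p q‖ * ‖g p‖ := by positivity
  calc _ = 2 * ((1 / ‖1 - (starRingEnd ℂ) p * p‖ * (1 - ‖p‖)) * (‖mobius p q‖ * ‖g p‖)) := by ring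
    _ ≤ 2 * (1 * (‖mobius p q‖ * ‖g p‖)) := by gcongr
    _ ≤ _ := by linarith

lemma lowA {a b ε : ℂ} {z : ℂ × ℂ} {φ₁ φ₂ : ℂ → ℂ} {ζ₁ ζ₂ ζ₃ : ℂ}
    (hφ : AnalyticDisc2 φ₁ φ₂) (h1 : ζ₁ ∈ unitDisc) (h2 : ζ₂ ∈ unitDisc) (h3 : ζ₃ ∈ unitDisc)
    (h23 : ζ₂ ≠ ζ₃) (e1 : φ₁ 0 = z.1) (e3 : φ₁ ζ₁ = a) (e5 : φ₁ ζ₂ = b) (e7 : φ₁ ζ₃ = b) :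
    ‖mobius z.1 a‖ * ‖mobius z.1 b‖ ≤ ‖ζ₁‖ * ‖ζ₂‖ * ‖ζ₃‖ := by
  have k1 := schwarz_pick hφ.1 hφ.2.2.1 h1 e3 zero_mem_disc
  have k2 := schwarz_pick2 hφ.1 hφ.2.2.1 h2 h3 h23 e5 e7 zero_mem_disc
  rw [e1, mobius_zero, mobius_norm_comm] at k1
  rw [e1, mobius_zero, mobius_zero, mobius_norm_comm] at k2
  rw [mul_assoc]
  exact mul_le_mul k1 k2 (norm_nonneg _) (norm_nonneg _)

lemma lowB {a b ε : ℂ} {z : ℂ × ℂ} {φ₁ φ₂ : ℂ → ℂ} {ζ₁ ζ₂ ζ₃ : ℂ}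
    (hφ : AnalyticDisc2 φ₁ φ₂) (h1 : ζ₁ ∈ unitDisc) (h2 : ζ₂ ∈ unitDisc) (h3 : ζ₃ ∈ unitDisc)
    (h12 : ζ₁ ≠ ζ₂) (e2 : φ₂ 0 = z.2) (e3 : φ₁ ζ₁ = a) (e4 : φ₂ ζ₁ = 0)
    (e6 : φ₂ ζ₂ = 0) (e7 : φ₁ ζ₃ = b) (e8 : φ₂ ζ₃ = ε) :
    ∃ x : ℝ, 0 ≤ x ∧ ‖z.2‖ ≤ ‖ζ₁‖ * ‖ζ₂‖ ∧ ‖z.2‖ ≤ ‖ζ₁‖ * ‖ζ₂‖ * ‖ζ₃‖ + 2 * x ∧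
      ‖mobius b a‖ * ‖mobius ζ₂ ζ₃‖ * x ≤ ‖ε‖ := by
  obtain ⟨h, hd, hb, he⟩ := two_zero hφ.2.1 (fun w hw => (mem_disc.1 (hφ.2.2.2 w hw)).le)
    h1 h2 h12 e4 e6
  have k0 := he 0 zero_mem_disc
  rw [e2, mobius_zero, mobius_zero, ← mul_assoc] at k0
  have k0' : ‖z.2‖ = ‖ζ₁‖ * ‖ζ₂‖ * ‖h 0‖ := by rw [k0, norm_mul, norm_mul]
  have k3 := he ζ₃ h3
  rw [e8] at k3
  have hP : ‖ζ₁‖ * ‖ζ₂‖ ≤ 1 :=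
    mul_le_one₀ (mem_disc.1 h1).le (norm_nonneg _) (mem_disc.1 h2).le
  refine ⟨‖h ζ₃‖, norm_nonneg _, ?_, ?_, ?_⟩
  · rw [k0']; exact mul_le_of_le_one_right (by positivity) (hb 0 zero_mem_disc)
  · have := norm_zero_le hd hb h3
    rw [k0']
    have h5 : ‖ζ₁‖ * ‖ζ₂‖ * ‖h 0‖ ≤ ‖ζ₁‖ * ‖ζ₂‖ * (‖ζ₃‖ + 2 * ‖h ζ₃‖) := by gcongr
    have h6 : ‖ζ₁‖ * ‖ζ₂‖ * (2 * ‖h ζ₃‖) ≤ 2 * ‖h ζ₃‖ :=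
      mul_le_of_le_one_left (by positivity) hP
    linarith
  · rw [k3, norm_mul, norm_mul, ← mul_assoc]
    have := schwarz_pick hφ.1 hφ.2.2.1 h1 e3 h3
    rw [e7, mobius_norm_comm] at this
    gcongr

/-- The perturbation step. -/
lemma toHasV {a b : ℂ} {z : ℂ × ℂ} {φ₁ φ₂ : ℂ → ℂ} {ζ₁ ζ₂ : ℂ} (ha : a ∈ unitDisc)
    (hφ : AnalyticDisc2 φ₁ φ₂) (h1 : ζ₁ ∈ unitDisc) (h2 : ζ₂ ∈ unitDisc)
    (h12 : ζ₁ ≠ ζ₂) (h20 : ζ₂ ≠ 0) (e1 : φ₁ 0 = z.1) (e2 : φ₂ 0 = z.2) (e3 : φ₁ ζ₁ = a)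
    (e4 : φ₂ ζ₁ = 0) (e5 : φ₁ ζ₂ = b) (e6 : φ₂ ζ₂ = 0) {r s κ : ℝ} (hr0 : 0 < r) (hr1 : r < 1)
    (hs1 : s < 1) (hs : ∀ ζ : ℂ, ‖ζ‖ ≤ r → ‖φ₁ ζ‖ ≤ s) (h2r : ‖ζ₂‖ < r)
    (hD : ‖deriv φ₁ ζ₂‖ ≤ (1 - s) / 8 * ‖ζ₂ * (ζ₂ - ζ₁)‖)
    (hA : r ≤ ‖ζ₁‖ → ‖ζ₂‖ * ‖ζ₂‖ < κ * r ^ 2)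
    (hB : ‖ζ₁‖ * ‖ζ₂‖ * ‖ζ₂‖ < κ * r ^ 3) : HasV a b z κ := by
  obtain ⟨s₂, hs₂, -, d2, -, b2⟩ := rescale hφ hr0 hr1
  have hrc : (r : ℂ) ≠ 0 := by exact_mod_cast hr0.ne'
  have n1 : ∀ x : ℂ, ‖x / (r : ℂ)‖ = ‖x‖ / r := fun x => by
    rw [norm_div, Complex.norm_real, Real.norm_of_nonneg hr0.le]
  have hq : ζ₂ / (r : ℂ) ∈ unitDisc := by rw [mem_disc, n1, div_lt_one hr0]; exact h2r
  set A := ζ₂ * (ζ₂ - ζ₁) with hAdef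
  have hA0 : A ≠ 0 := mul_ne_zero h20 (sub_ne_zero.2 h12.symm)
  set Q : ℂ → ℂ := fun ζ => ζ * (ζ - ζ₁) * (ζ - ζ₂) with hQ
  have hQd : Differentiable ℂ Q := by simp only [hQ]; fun_prop
  set C := deriv φ₁ ζ₂ / A with hC
  have hCn : ‖C‖ ≤ (1 - s) / 8 := by
    rw [hC, norm_div, div_le_iff₀ (norm_pos_iff.2 hA0)]; exact hD
  set ψ : ℂ → ℂ := fun ζ => φ₁ ζ - C * Q ζ with hψ
  have hψd : DifferentiableOn ℂ ψ unitDisc := hφ.1.sub (hQd.differentiableOn.const_mul C)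
  have hψ' : HasDerivAt ψ 0 ζ₂ := by
    have := (hφ.1.differentiableAt (isOpen_disc.mem_nhds h2)).hasDerivAt.sub
      ((hasDerivAt_Q ζ₁ ζ₂).const_mul C)
    refine this.congr_deriv ?_
    rw [hC, ← hAdef, div_mul_cancel₀ _ hA0, sub_self]
  have hψ0 : ψ 0 = z.1 := by simp [hψ, hQ, e1]
  have hψ1 : ψ ζ₁ = a := by simp [hψ, hQ, e3]
  have hψ2 : ψ ζ₂ = b := by simp [hψ, hQ, e5]
  have hn : ∀ ζ ∈ unitDisc, ‖(r : ℂ) * ζ‖ ≤ r := by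
    intro ζ hζ
    have := mem_disc.1 hζ
    rw [norm_mul, Complex.norm_real, Real.norm_of_nonneg hr0.le]
    nlinarith
  have hmem : ∀ ζ ∈ unitDisc, (r : ℂ) * ζ ∈ unitDisc := fun ζ hζ =>
    mem_disc.2 ((hn ζ hζ).trans_lt hr1)
  have d1 : DifferentiableOn ℂ (fun ζ => ψ (r * ζ)) unitDisc :=
    hψd.comp (by fun_prop) hmem
  have b1 : ∀ ζ ∈ unitDisc, ‖ψ (r * ζ)‖ ≤ (1 + s) / 2 := by
    intro ζ hζ
    have k1 : ‖C * Q (r * ζ)‖ ≤ (1 - s) / 8 * 4 := by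
      rw [norm_mul]
      exact mul_le_mul hCn (norm_Q_le h1 h2 (hmem ζ hζ)) (norm_nonneg _) (by linarith)
    have k2 := norm_sub_le (φ₁ (r * ζ)) (C * Q (r * ζ))
    have k3 := hs _ (hn ζ hζ)
    simp only [hψ]
    linarith
  have hdr : deriv (fun ζ => ψ (r * ζ)) (ζ₂ / (r : ℂ)) = 0 := by
    have i1 : HasDerivAt ψ 0 ((r : ℂ) * (ζ₂ / (r : ℂ))) := by
      rw [mul_div_cancel₀ _ hrc]; exact hψ'
    have i2 : HasDerivAt (fun ζ : ℂ => (r : ℂ) * ζ) (r : ℂ) (ζ₂ / (r : ℂ)) := by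
      simpa using (hasDerivAt_id (ζ₂ / (r : ℂ))).const_mul (r : ℂ)
    have := i1.comp _ i2
    rw [zero_mul] at this
    exact this.deriv
  have v10 : ψ (r * 0) = z.1 := by rw [mul_zero, hψ0]
  have v20 : φ₂ (r * 0) = z.2 := by rw [mul_zero, e2]
  have v1p : ψ (r * (ζ₁ / (r : ℂ))) = a := by rw [mul_div_cancel₀ _ hrc, hψ1]
  have v2p : φ₂ (r * (ζ₁ / (r : ℂ))) = 0 := by rw [mul_div_cancel₀ _ hrc, e4]
  have v1q : ψ (r * (ζ₂ / (r : ℂ))) = b := by rw [mul_div_cancel₀ _ hrc, hψ2]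
  have v2q : φ₂ (r * (ζ₂ / (r : ℂ))) = 0 := by rw [mul_div_cancel₀ _ hrc, e6]
  by_cases h1r : ‖ζ₁‖ < r
  · have hp : ζ₁ / (r : ℂ) ∈ unitDisc := by rw [mem_disc, n1, div_lt_one hr0]; exact h1r
    refine ⟨fun ζ => ψ (r * ζ), fun ζ => φ₂ (r * ζ), ζ₁ / r, ζ₂ / r, ⟨d1, d2, ?_, ?_⟩, hp, hq,
      v10, v20, v1p, v2p, v1q, v2q, hdr, ?_⟩
    · intro w hw; rw [mem_disc]; exact (b1 w hw).trans_lt (by linarith)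
    · intro w hw; rw [mem_disc]; exact (b2 w hw).trans_lt hs₂
    · rw [n1, n1, div_mul_div_comm, div_mul_div_comm, div_lt_iff₀ (by positivity)]
      calc _ < _ := hB
        _ = _ := by ring
  · push Not at h1r
    have hAA := hA h1r
    obtain ⟨w, hw, η, hη, H⟩ := addPole (s := max ((1 + s) / 2) s₂) d1 d2
      (max_lt (by linarith) hs₂) (fun ζ hζ => (b1 ζ hζ).trans (le_max_left _ _))
      (fun ζ hζ => (b2 ζ hζ).trans (le_max_right _ _)) hq hq ha
    obtain ⟨g₁, g₂, hg, k1, k2, k3, k4, -, -, k7, k8, k9⟩ := H 0 (by simpa using hη)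
    refine ⟨g₁, g₂, w, ζ₂ / r, hg, hw, hq, k1.trans v10, k2.trans v20, k7, k8, k3.trans v1q,
      k4.trans v2q, k9 rfl hdr, ?_⟩
    have l1 : ‖ζ₂ / (r : ℂ)‖ * ‖ζ₂ / (r : ℂ)‖ < κ := by
      rw [n1, div_mul_div_comm, div_lt_iff₀ (by positivity)]
      calc _ < _ := hAA
        _ = _ := by ring
    rw [mul_assoc]
    exact (mul_le_of_le_one_left (by positivity) (mem_disc.1 hw).le).trans_lt l1

lemma exists_r {κ₂ κ₃ σ : ℝ} (h : κ₂ < κ₃) (hσ : σ < 1) :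
    ∃ r : ℝ, 0 < r ∧ r < 1 ∧ σ < r ∧ κ₂ < κ₃ * r ^ 3 := by
  have c1 : Tendsto (fun r : ℝ => κ₃ * r ^ 3) (𝓝 1) (𝓝 κ₃) := by
    have : Continuous (fun r : ℝ => κ₃ * r ^ 3) := by fun_prop
    simpa using this.tendsto 1
  have := (lt_mem_nhds (one_pos (α := ℝ))).and
      ((lt_mem_nhds hσ).and (c1.eventually_const_lt h))
  obtain ⟨r, ⟨h1, h2, h3⟩, hr⟩ :=
    ((this.filter_mono (nhdsWithin_le_nhds (s := Set.Iio 1))).and self_mem_nhdsWithin).exists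
  exact ⟨r, h1, hr, h2, h3⟩

lemma small_lin {x y : ℝ} (h : x < y) (c : ℝ) : ∀ᶠ δ in 𝓝 (0 : ℝ), x + c * δ < y := by
  have : Continuous (fun δ : ℝ => x + c * δ) := by fun_prop
  have h2 := this.tendsto 0
  simp only [mul_zero, add_zero] at h2
  exact h2.eventually_lt_const h

lemma lower {a b : ℂ} (ha : a ∈ unitDisc) (hb : b ∈ unitDisc) (hab : a ≠ b) {z : ℂ × ℂ}
    (hz1 : z.1 ∈ unitDisc) (hz2 : z.2 ∈ unitDisc) {κ₂ κ₃ : ℝ} (hκ0 : 0 < κ₂) (hκ : κ₂ < κ₃) :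
    ∀ᶠ ε in 𝓝[≠] (0 : ℂ), Has3 a b ε z κ₂ → Has2 a b z κ₃ ∨ HasV a b z κ₃ := by
  by_cases hM : ‖z.2‖ < κ₃
  · filter_upwards [self_mem_nhdsWithin] with ε hε h
    obtain ⟨φ₁, φ₂, ζ₁, ζ₂, ζ₃, hφ, h1, h2, h3, e1, e2, e3, e4, e5, e6, e7, e8, hk⟩ := h
    have h23 : ζ₂ ≠ ζ₃ := by
      rintro rfl; exact hε (e8.symm.trans e6)
    left
    exact has2_of_lt ha hb hz1 hz2 hM
      ((lowA (ε := ε) hφ h1 h2 h3 h23 e1 e3 e5 e7).trans_lt (hk.trans hκ))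
  push Not at hM
  have hκ3 : 0 < κ₃ := hκ0.trans hκ
  have hσ : κ₂ / κ₃ < 1 := (div_lt_one hκ3).2 hκ
  obtain ⟨r, hr0, hr1, hσr, hr3⟩ := exists_r hκ hσ
  obtain ⟨s, -, hs1, hs⟩ := schwarz_bound (mem_disc.1 hz1) hr1
  set m := ‖mobius b a‖ with hm
  have hm0 : 0 < m := by
    rw [hm, norm_pos_iff]
    intro h; exact hab (mobius_eq_zero (mem_disc.1 hb) (mem_disc.1 ha) h)
  have hr' : 0 < 1 - r := by linarith
  have hs' : 0 < 1 - s := by linarith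
  have hev := ((small_lin hσr 2).and ((small_lin hr3 2).and ((small_lin hκ (2 / m)).and
    (small_lin (x := 0) (y := (1 - s) / 8 * (κ₃ * (m * (1 - r)))) (by positivity)
      (2 / (1 - r))))))
  obtain ⟨δ, ⟨D1, D2, D3, D4⟩, hδ⟩ :=
    ((hev.filter_mono (nhdsWithin_le_nhds (s := Set.Ioi 0))).and self_mem_nhdsWithin).exists
  have hδ0 : 0 < δ := hδ
  filter_upwards [self_mem_nhdsWithin, small_eps (show 0 < δ * δ by positivity)] with ε hε hεδ h
  obtain ⟨φ₁, φ₂, ζ₁, ζ₂, ζ₃, hφ, h1, h2, h3, e1, e2, e3, e4, e5, e6, e7, e8, hk⟩ := h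
  have h23 : ζ₂ ≠ ζ₃ := by
    rintro rfl; exact hε (e8.symm.trans e6)
  have h12 : ζ₁ ≠ ζ₂ := by
    rintro rfl; exact hab (e3.symm.trans e5)
  have h1' := mem_disc.1 h1
  have h2' := mem_disc.1 h2
  have h3' := mem_disc.1 h3
  obtain ⟨x, hx0, x1, x2, x3⟩ := lowB hφ h1 h2 h3 h12 e2 e3 e4 e6 e7 e8
  rw [← hm] at x3
  have hP : κ₃ ≤ ‖ζ₁‖ * ‖ζ₂‖ := hM.trans x1
  have hmob : ‖mobius ζ₂ ζ₃‖ < δ := by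
    by_contra hcon
    push Not at hcon
    have y1 : m * δ * x ≤ m * ‖mobius ζ₂ ζ₃‖ * x := by gcongr
    have y2 : (m * x) * δ < δ * δ := by linarith
    have y3 : m * x < δ := lt_of_mul_lt_mul_right y2 hδ0.le
    have y4 : x < δ / m := by rw [lt_div_iff₀ hm0]; linarith
    have y5 : 2 / m * δ = 2 * (δ / m) := by ring
    linarith
  have hdist : ‖ζ₂‖ ≤ ‖ζ₃‖ + 2 * δ := by
    have y1 := (sub_le_mobius h2 h3).1
    have y2 := norm_sub_norm_le ζ₂ ζ₃
    linarith
  have hζ3 : ‖ζ₃‖ ≤ κ₂ / κ₃ := by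
    rw [le_div_iff₀ hκ3]
    have : ‖ζ₃‖ * κ₃ ≤ ‖ζ₃‖ * (‖ζ₁‖ * ‖ζ₂‖) := by gcongr
    linarith
  have h2r : ‖ζ₂‖ < r := by linarith
  have hζ2 : κ₃ ≤ ‖ζ₂‖ := hP.trans (mul_le_of_le_one_left (norm_nonneg _) h1'.le)
  have h20 : ζ₂ ≠ 0 := by
    rw [← norm_pos_iff]; linarith
  have hB : ‖ζ₁‖ * ‖ζ₂‖ * ‖ζ₂‖ < κ₃ * r ^ 3 := by
    have y1 : ‖ζ₁‖ * ‖ζ₂‖ * ‖ζ₂‖ ≤ ‖ζ₁‖ * ‖ζ₂‖ * (‖ζ₃‖ + 2 * δ) := by gcongr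
    have y2 : ‖ζ₁‖ * ‖ζ₂‖ * (2 * δ) ≤ 2 * δ := mul_le_of_le_one_left (by positivity)
      (mul_le_one₀ h1'.le (norm_nonneg _) h2'.le)
    linarith
  right
  refine toHasV ha hφ h1 h2 h12 h20 e1 e2 e3 e4 e5 e6 hr0 hr1 hs1
    (fun ζ hζ => hs φ₁ hφ.1 hφ.2.2.1 (by rw [e1]) ζ hζ) h2r ?_ ?_ hB
  · have y1 := deriv_bound hφ.1 hφ.2.2.1 h2 h3 h23 e5 e7
    have y2 : ‖deriv φ₁ ζ₂‖ * (1 - r) ≤ ‖deriv φ₁ ζ₂‖ * (1 - ‖ζ₂‖) := by gcongr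
    have y3 : ‖deriv φ₁ ζ₂‖ ≤ 2 / (1 - r) * δ := by
      rw [div_mul_eq_mul_div, le_div_iff₀ hr']; linarith
    have y4 : m ≤ ‖mobius ζ₂ ζ₁‖ := by
      have := schwarz_pick hφ.1 hφ.2.2.1 h2 e5 h1
      rwa [e3] at this
    have y5 := (sub_le_mobius h2 h1).2
    have y6 : κ₃ * (m * (1 - r)) ≤ ‖ζ₂ * (ζ₂ - ζ₁)‖ := by
      rw [norm_mul]
      have : m * (1 - r) ≤ ‖mobius ζ₂ ζ₁‖ * (1 - ‖ζ₂‖) := by gcongr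
      have y7 := this.trans y5
      gcongr
    have y8 : (1 - s) / 8 * (κ₃ * (m * (1 - r))) ≤ (1 - s) / 8 * ‖ζ₂ * (ζ₂ - ζ₁)‖ := by gcongr
    linarith
  · intro hr1'
    have y1 : r * (‖ζ₂‖ * ‖ζ₂‖) ≤ ‖ζ₁‖ * (‖ζ₂‖ * ‖ζ₂‖) := by gcongr
    have y2 : r * (‖ζ₂‖ * ‖ζ₂‖) < r * (κ₃ * r ^ 2) := by
      calc _ ≤ _ := y1
        _ = ‖ζ₁‖ * ‖ζ₂‖ * ‖ζ₂‖ := by ring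
        _ < _ := hB
        _ = _ := by ring
    exact lt_of_mul_lt_mul_left y2 hr0.le

/-- Theorem `liml3bepsilon=`: as the pole `(b,ε)` collides with `(b,0)`, the
three-pole Lempert functions converge to the corrected generalized Lempert function
`𝐿̃_{a0bV} = min {L_{a0b0}, L_{a0bV}}`. -/
theorem tendsto_Leps3_collision
    (a b : ℂ) (ha : a ∈ unitDisc) (hb : b ∈ unitDisc) (hab : a ≠ b)
    (z : ℂ × ℂ) (hz1 : z.1 ∈ unitDisc) (hz2 : z.2 ∈ unitDisc) :
    Tendsto (fun ε => Leps3 a b ε z) (𝓝[≠] (0 : ℂ))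
      (𝓝 (min (La0b0 a b z) (La0bV a b z))) := by
  refine tendsto_order.2 ⟨fun c hc => ?_, fun c hc => ?_⟩
  · obtain ⟨c₂, h1, h2⟩ := EReal.lt_iff_exists_real_btwn.1 hc
    obtain ⟨c₃, h3, h4⟩ := EReal.lt_iff_exists_real_btwn.1 h2
    have h23 : Real.exp c₂ < Real.exp c₃ := Real.exp_lt_exp.2 (EReal.coe_lt_coe_iff.1 h3)
    filter_upwards [lower ha hb hab hz1 hz2 (Real.exp_pos c₂) h23] with ε hε
    refine h1.trans_le ?_
    by_contra hcon
    push Not at hcon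
    obtain ⟨k1, k2⟩ := lt_min_iff.1 h4
    rcases hε (Leps3_lt.1 hcon) with h | h
    · exact lt_asymm k1 (La0b0_lt.2 h)
    · exact lt_asymm k2 (La0bV_lt.2 h)
  · obtain ⟨c', h1, h2⟩ := EReal.lt_iff_exists_real_btwn.1 hc
    rcases min_lt_iff.1 h1 with h | h
    · filter_upwards [upper1 hb (La0b0_lt.1 h)] with ε hε
      exact (Leps3_lt.2 hε).trans h2
    · filter_upwards [upper2 hb hab (La0bV_lt.1 h)] with ε hε
      exact (Leps3_lt.2 hε).trans h2
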